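/- Let b ≥ 2 be an integer base. For every i ∈ I and every n ≥ 2, K_i(n) = c_{i,n}·(b^{B(n)} + 1) + K_{i−2c_{i,n}}(h_{i,n}); moreover 1 ≤ c_{i,n} ≤ b−1 (with c_{i,n} ≤ (b−1)/2 if b is odd) and 0 ≤ K_{i−2c_{i,n}}(h_{i,n}) ≤ (b−1)·B(n) − 2. -/

import Mathlib

namespace Kaprekar

/-- Sum of the digits of `v` in base `b`. -/
def s (b v : ℕ) : ℕ := (Nat.digits b v).sum

/-- `f v = v + s v`. -/
def f (b v : ℕ) : ℕ := v + s b v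

/-- `F u` is the number of generators of `u`. -/
noncomputable def F (b u : ℕ) : ℕ := Set.ncard {v : ℕ | f b v = u}

/-- `K n` is the least `u` with exactly `n` generators. -/
noncomputable def K (b n : ℕ) : ℕ := sInf {u : ℕ | F b u = n}

/-- `B n = ⌊log_b K(n)⌋`. -/
noncomputable def B (b n : ℕ) : ℕ := Nat.log b (K b n)

/-- `Ki i n` is the least `u ≡ i (mod b-1)` with exactly `n` generators. -/
noncomputable def Ki (b : ℕ) (i : ZMod (b - 1)) (n : ℕ) : ℕ :=
  sInf {u : ℕ | F b u = n ∧ (u : ZMod (b - 1)) = i}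

/-- The index set `I`: all residues mod `b-1` if `b` is even, the even residues if `b` is odd. -/
def I (b : ℕ) : Set (ZMod (b - 1)) := {i | Even b ∨ ∃ j : ZMod (b - 1), i = 2 * j}

/-- `K'_i(n) = min { K_i(⌈n/2⌉)+K_{-i-2}(⌊n/2⌋), K_i(⌊n/2⌋)+K_{-i-2}(⌈n/2⌉) }`. -/
noncomputable def K' (b : ℕ) (i : ZMod (b - 1)) (n : ℕ) : ℕ :=
  min (Ki b i ((n + 1) / 2) + Ki b (-i - 2) (n / 2))
      (Ki b i (n / 2) + Ki b (-i - 2) ((n + 1) / 2))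

/-- `c_{i,n}`: the smallest `c ≥ 1` such that `K'_{i-2c}(n) = min_{j ∈ I} K'_j(n)`. -/
noncomputable def cc (b : ℕ) (i : ZMod (b - 1)) (n : ℕ) : ℕ :=
  sInf {c : ℕ | 1 ≤ c ∧
    K' b (i - 2 * (c : ZMod (b - 1))) n = sInf {x : ℕ | ∃ j ∈ I b, x = K' b j n}}

/-- `h_{i,n}`: either `⌈n/2⌉` or `⌊n/2⌋`, as in the paper. -/
noncomputable def hh (b : ℕ) (i : ZMod (b - 1)) (n : ℕ) : ℕ :=
  if Ki b (i - 2 * (cc b i n : ZMod (b - 1))) ((n + 1) / 2) +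
       Ki b (2 * (cc b i n : ZMod (b - 1)) - i - 2) (n / 2) <
     Ki b (i - 2 * (cc b i n : ZMod (b - 1))) (n / 2) +
       Ki b (2 * (cc b i n : ZMod (b - 1)) - i - 2) ((n + 1) / 2)
  then (n + 1) / 2 else n / 2

lemma s_mul_add (b q r : ℕ) (hb : 2 ≤ b) (hr : r < b) : s b (q * b + r) = s b q + r := by
  unfold s
  rcases Nat.eq_zero_or_pos (q * b + r) with h | h
  · have hr0 : r = 0 := by omega
    have hq0 : q = 0 := by
      have : q * b = 0 := by omega
      rcases Nat.mul_eq_zero.1 this with h | h <;> omega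
    simp [hr0, hq0]
  · rw [Nat.digits_def' (by omega) h]
    have h1 : (q * b + r) % b = r := by
      rw [Nat.add_comm, Nat.add_mul_mod_self_right, Nat.mod_eq_of_lt hr]
    have h2 : (q * b + r) / b = q := by
      rw [Nat.add_comm, Nat.add_mul_div_right _ _ (by omega), Nat.div_eq_of_lt hr, Nat.zero_add]
    rw [h1, h2, List.sum_cons, Nat.add_comm]

lemma s_of_lt (b r : ℕ) (hb : 2 ≤ b) (hr : r < b) : s b r = r := by
  have h := s_mul_add b 0 r hb hr
  simpa [s] using h

lemma s_leading (b : ℕ) (hb : 2 ≤ b) (m : ℕ) :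
    ∀ c w, c < b → w < b ^ m → s b (c * b ^ m + w) = c + s b w := by
  induction m with
  | zero =>
    intro c w hc hw
    have : w = 0 := by simpa using hw
    subst this
    simp [s_of_lt b c hb hc, s_of_lt b 0 hb (by omega)]
  | succ m ih =>
    intro c w hc hw
    have hw' : w / b < b ^ m := Nat.div_lt_of_lt_mul (by rwa [pow_succ, mul_comm] at hw)
    have hr : w % b < b := Nat.mod_lt _ (by omega)
    have e : c * b ^ (m + 1) + w = (c * b ^ m + w / b) * b + w % b := by
      conv_lhs => rw [← Nat.div_add_mod w b]
      ring
    have e' : s b w = s b (w / b) + w % b := by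
      conv_lhs => rw [← Nat.div_add_mod w b, mul_comm]
      exact s_mul_add b _ _ hb hr
    rw [e, s_mul_add b _ _ hb hr, ih c _ hc hw', e']
    omega

lemma s_compl (b : ℕ) (hb : 2 ≤ b) (m : ℕ) :
    ∀ w w', w + w' + 1 = b ^ m → s b w + s b w' = (b - 1) * m := by
  induction m with
  | zero =>
    intro w w' h
    have h0 : w = 0 := by simp at h; omega
    have h0' : w' = 0 := by simp at h; omega
    subst h0 h0'
    simp [s]
  | succ m ih =>
    intro w w' h
    have key : ∀ v, s b v = s b (v / b) + v % b := by
      intro v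
      conv_lhs => rw [← Nat.div_add_mod v b, mul_comm]
      exact s_mul_add b _ _ hb (Nat.mod_lt _ (by omega))
    have h1 := Nat.div_add_mod w b
    have h1' := Nat.div_add_mod w' b
    have hr : w % b < b := Nat.mod_lt _ (by omega)
    have hr' : w' % b < b := Nat.mod_lt _ (by omega)
    have hsum : b * (w / b + w' / b) + (w % b + w' % b + 1) = b * b ^ m := by
      rw [pow_succ, mul_comm (b ^ m) b] at h
      rw [← h]
      conv_rhs => rw [← h1, ← h1']
      ring
    have hd : b ∣ w % b + w' % b + 1 :=
      (Nat.dvd_add_right (Dvd.intro _ rfl)).1 (hsum ▸ Dvd.intro _ rfl)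
    obtain ⟨t, ht⟩ := hd
    have ht1 : t = 1 := by
      have : t < 2 := by
        by_contra hcon
        have : b * 2 ≤ b * t := Nat.mul_le_mul_left _ (by omega)
        omega
      have : t ≠ 0 := by rintro rfl; omega
      omega
    subst ht1
    have hq : w / b + w' / b + 1 = b ^ m := by
      have : b * (w / b + w' / b + 1) = b * b ^ m := by rw [← hsum, ht]; ring
      exact Nat.eq_of_mul_eq_mul_left (by omega) this
    have := ih _ _ hq
    rw [key w, key w', Nat.mul_succ]
    omega

lemma f_leading (b : ℕ) (hb : 2 ≤ b) (m c w : ℕ) (hc : c < b) (hw : w < b ^ m) :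
    f b (c * b ^ m + w) = c * (b ^ m + 1) + f b w := by
  unfold f
  rw [s_leading b hb m c w hc hw]
  ring

lemma f_compl (b : ℕ) (hb : 2 ≤ b) (m w w' : ℕ) (h : w + w' + 1 = b ^ m) :
    f b w + f b w' + 1 = b ^ m + (b - 1) * m := by
  have := s_compl b hb m w w' h
  unfold f
  omega

lemma le_f (b v : ℕ) : v ≤ f b v := Nat.le_add_right _ _

lemma bernoulli (b : ℕ) (hb : 2 ≤ b) (m : ℕ) : (b - 1) * m + 1 ≤ b ^ m := by
  induction m with
  | zero => simp
  | succ m ih =>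
    have h1 : 1 ≤ b ^ m := Nat.one_le_pow _ _ (by omega)
    have h2 : b ^ (m + 1) = (b - 1) * b ^ m + b ^ m := by
      obtain ⟨d, rfl⟩ : ∃ d, b = d + 1 := ⟨b - 1, by omega⟩
      simp; ring
    have h3 : (b - 1) * 1 ≤ (b - 1) * b ^ m := Nat.mul_le_mul_left _ h1
    rw [h2, Nat.mul_succ]
    omega

lemma finite_generators (b u : ℕ) : {v : ℕ | f b v = u}.Finite :=
  (Set.finite_Iic u).subset fun v hv => by
    have := le_f b v
    simp only [Set.mem_ofPred_eq] at hv
    simp only [Set.mem_Iic]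
    omega

lemma F_pos_iff (b u : ℕ) : 1 ≤ F b u ↔ ∃ v, f b v = u := by
  unfold F
  rw [Nat.one_le_iff_ne_zero, ← Nat.pos_iff_ne_zero, Set.ncard_pos (finite_generators b u)]
  rfl

/-- Generators of a number `u` with `b ^ m ≤ u < b ^ (m + 1)`, sorted by their leading digit. -/
lemma F_split (b : ℕ) (hb : 2 ≤ b) (m c k u : ℕ) (hc : 1 ≤ c)
    (hu : u + 1 = c * (b ^ m + 1) + k) (hk : k ≤ b ^ m) (hlt : u < b ^ (m + 1)) :
    F b u = {w | f b w + 1 = k}.ncard + {w | f b w + k + 1 = (b - 1) * m}.ncard := by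
  have hB := bernoulli b hb m
  have hcb : c < b := by
    by_contra h
    have h1 : b * (b ^ m + 1) ≤ c * (b ^ m + 1) := Nat.mul_le_mul_right _ (by omega)
    have h2 : b * (b ^ m + 1) = b ^ (m + 1) + b := by ring
    omega
  obtain ⟨d, rfl⟩ : ∃ d, c = d + 1 := ⟨c - 1, by omega⟩
  have hexp : (d + 1) * (b ^ m + 1) = d * b ^ m + d + b ^ m + 1 := by ring
  have hset : {v | f b v = u} = (fun w => (d + 1) * b ^ m + w) '' {w | f b w + 1 = k} ∪
      (fun w => (d + 1) * b ^ m - 1 - w) '' {w | f b w + k + 1 = (b - 1) * m} := by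
    ext v
    simp only [Set.mem_union, Set.mem_image, Set.mem_ofPred_eq]
    constructor
    · intro hv
      have hvu := le_f b v
      have hpos : 0 < b ^ m := by positivity
      have hw : v % b ^ m < b ^ m := Nat.mod_lt _ hpos
      have hdm := Nat.div_add_mod v (b ^ m)
      have hcl : v / b ^ m < b := Nat.div_lt_of_lt_mul (by rw [← pow_succ]; omega)
      generalize v / b ^ m = e at *
      generalize v % b ^ m = w at *
      have hfv : f b v = e * (b ^ m + 1) + f b w := by
        rw [← hdm, mul_comm, f_leading b hb m e w hcl hw]
      have hcompl := f_compl b hb m w (b ^ m - 1 - w) (by omega)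
      have hcases : e = d + 1 ∨ e = d := by
        by_contra hne
        rcases Nat.lt_or_ge e d with h | h
        · obtain ⟨x, rfl⟩ : ∃ x, d = e + 1 + x := ⟨d - e - 1, by omega⟩
          have e1 : (e + 1 + x + 1) * (b ^ m + 1) =
            e * (b ^ m + 1) + x * (b ^ m + 1) + 2 * b ^ m + 2 := by ring
          have := Nat.zero_le (x * (b ^ m + 1))
          omega
        · obtain ⟨x, rfl⟩ : ∃ x, e = d + 1 + 1 + x := ⟨e - d - 2, by omega⟩
          have e1 : (d + 1 + 1 + x) * (b ^ m + 1) =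
            (d + 1) * (b ^ m + 1) + x * (b ^ m + 1) + b ^ m + 1 := by ring
          have := Nat.zero_le (x * (b ^ m + 1))
          omega
      rcases hcases with rfl | rfl
      · left
        refine ⟨w, by omega, ?_⟩
        rw [← hdm]; ring
      · right
        have e1 : e * (b ^ m + 1) = e * b ^ m + e := by ring
        refine ⟨b ^ m - 1 - w, by omega, ?_⟩
        have e2 : (e + 1) * b ^ m = e * b ^ m + b ^ m := by ring
        rw [mul_comm] at hdm
        omega
    · rintro (⟨w, hw, rfl⟩ | ⟨w, hw, rfl⟩)
      · have := le_f b w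
        rw [f_leading b hb m (d + 1) w hcb (by omega)]
        omega
      · have := le_f b w
        have e1 : (d + 1) * b ^ m - 1 - w = d * b ^ m + (b ^ m - 1 - w) := by
          have e2 : (d + 1) * b ^ m = d * b ^ m + b ^ m := by ring
          omega
        have hcompl := f_compl b hb m w (b ^ m - 1 - w) (by omega)
        have e3 : d * (b ^ m + 1) = d * b ^ m + d := by ring
        rw [e1, f_leading b hb m d _ (by omega) (by omega)]
        omega
  have hlt' : ∀ w, f b w + k + 1 = (b - 1) * m → w + 1 ≤ (d + 1) * b ^ m := by
    intro w hw
    have := le_f b w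
    have e2 : (d + 1) * b ^ m = d * b ^ m + b ^ m := by ring
    omega
  have hfin : ∀ {P : ℕ → Prop} (N : ℕ), (∀ w, P w → f b w ≤ N) → {w | P w}.Finite := by
    intro P N h
    refine (Set.finite_Iic N).subset fun w hw => ?_
    exact (le_f b w).trans (h w hw)
  unfold F
  rw [hset, Set.ncard_union_eq ?_ ((hfin k fun w hw => by omega).image _)
    ((hfin ((b - 1) * m) fun w hw => by omega).image _)]
  · rw [Set.ncard_image_of_injective _ (add_right_injective _), Set.InjOn.ncard_image]
    intro x hx y hy hxy
    have h1 := hlt' x hx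
    have h2 := hlt' y hy
    simp only at hxy
    omega
  · rw [Set.disjoint_left]
    rintro _ ⟨w, hw, rfl⟩ ⟨w', hw', h⟩
    have := hlt' w' hw'
    simp only at h
    omega

lemma F_eq_add (b : ℕ) (hb : 2 ≤ b) (m c k k' : ℕ) (hc : 1 ≤ c) (hk : k + k' + 2 = (b - 1) * m)
    (hlt : c * (b ^ m + 1) + k < b ^ (m + 1)) :
    F b (c * (b ^ m + 1) + k) = F b k + F b k' := by
  have hB := bernoulli b hb m
  rw [F_split b hb m c (k + 1) _ hc (by ring) (by omega) hlt]
  unfold F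
  congr 2 <;> ext w <;> simp only [Set.mem_ofPred_eq] <;> omega

/-- A number with `n` generators, lying above a power of `b` below which no number has `n`
generators, splits. -/
lemma exists_split (b : ℕ) (hb : 2 ≤ b) (m u n : ℕ) (hn : 1 ≤ n) (hu : F b u = n)
    (hge : b ^ m ≤ u) (hlt : u < b ^ (m + 1)) (hmin : ∀ x, F b x = n → b ^ m ≤ x) :
    ∃ c k k', 1 ≤ c ∧ c ≤ b - 1 ∧ u = c * (b ^ m + 1) + k ∧ k + k' + 2 = (b - 1) * m ∧
      F b k + F b k' = n ∧ 1 ≤ F b k ∧ 1 ≤ F b k' := by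
  have hB := bernoulli b hb m
  have hdm := Nat.div_add_mod (u + 1) (b ^ m + 1)
  have hmod : (u + 1) % (b ^ m + 1) < b ^ m + 1 := Nat.mod_lt _ (by omega)
  have hc : 1 ≤ (u + 1) / (b ^ m + 1) := Nat.div_pos (by omega) (by omega)
  generalize (u + 1) / (b ^ m + 1) = c at *
  generalize (u + 1) % (b ^ m + 1) = r at *
  rw [mul_comm] at hdm
  have hcb : c < b := by
    by_contra h
    have h1 : b * (b ^ m + 1) ≤ c * (b ^ m + 1) := Nat.mul_le_mul_right _ (by omega)
    have h2 : b * (b ^ m + 1) = b ^ (m + 1) + b := by ring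
    omega
  have hF := F_split b hb m c r u hc hdm.symm (by omega) hlt
  rcases Nat.eq_zero_or_pos r with rfl | hr
  · exfalso
    have e1 : {w | f b w + 1 = 0} = ∅ := by ext; simp
    rw [e1, Set.ncard_empty, zero_add] at hF
    rcases Nat.eq_zero_or_pos ((b - 1) * m) with h0 | h0
    · have e2 : {w | f b w + 0 + 1 = (b - 1) * m} = ∅ := by
        ext w
        simp only [Set.mem_ofPred_eq, Set.mem_empty_iff_false, iff_false]
        omega
      rw [e2, Set.ncard_empty] at hF
      omega
    · have := hmin ((b - 1) * m - 1) (by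
        rw [← hu, hF]
        unfold F
        congr 1; ext w; simp only [Set.mem_ofPred_eq]; omega)
      omega
  · obtain ⟨k, rfl⟩ : ∃ k, r = k + 1 := ⟨r - 1, by omega⟩
    have e1 : {w | f b w + 1 = k + 1}.ncard = F b k := by
      unfold F
      congr 1; ext w; simp only [Set.mem_ofPred_eq]; omega
    rw [e1] at hF
    have hkn : F b k ≠ n := fun h => by have := hmin k h; omega
    by_cases hle : k + 2 ≤ (b - 1) * m
    · obtain ⟨k', hk'⟩ := Nat.exists_eq_add_of_le hle
      have e2 : {w | f b w + (k + 1) + 1 = (b - 1) * m}.ncard = F b k' := by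
        unfold F
        congr 1; ext w; simp only [Set.mem_ofPred_eq]; omega
      rw [e2] at hF
      have hkn' : F b k' ≠ n := fun h => by have := hmin k' h; omega
      exact ⟨c, k, k', hc, by omega, by omega, by omega, by omega, by omega, by omega⟩
    · exfalso
      have e2 : {w | f b w + (k + 1) + 1 = (b - 1) * m} = ∅ := by
        ext w
        simp only [Set.mem_ofPred_eq, Set.mem_empty_iff_false, iff_false]
        omega
      rw [e2, Set.ncard_empty] at hF
      omega

lemma cast_base (b : ℕ) (hb : 2 ≤ b) : ((b : ℕ) : ZMod (b - 1)) = 1 := by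
  have h : ((b - 1 : ℕ) : ZMod (b - 1)) = 0 := ZMod.natCast_self _
  have e : b = (b - 1) + 1 := by omega
  calc ((b : ℕ) : ZMod (b - 1)) = (((b - 1) + 1 : ℕ) : ZMod (b - 1)) := by rw [← e]
    _ = 1 := by rw [Nat.cast_add, h, zero_add, Nat.cast_one]

lemma cast_f (b : ℕ) (hb : 2 ≤ b) (v : ℕ) : (f b v : ZMod (b - 1)) = 2 * v := by
  have h : (v : ZMod (b - 1)) = (s b v : ZMod (b - 1)) := by
    have h1 : b ≡ 1 [MOD (b - 1)] :=
      (ZMod.natCast_eq_natCast_iff _ _ _).1 (by rw [cast_base b hb, Nat.cast_one])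
    have h2 := Nat.ofDigits_modEq' b 1 (b - 1) h1 (Nat.digits b v)
    rw [Nat.ofDigits_digits, Nat.ofDigits_one] at h2
    exact (ZMod.natCast_eq_natCast_iff _ _ _).2 h2
  unfold f
  push_cast
  rw [← h]; ring

lemma mem_I_iff (b : ℕ) (hb : 2 ≤ b) (i : ZMod (b - 1)) : i ∈ I b ↔ ∃ y, i = 2 * y := by
  constructor
  · rintro (⟨t, ht⟩ | h)
    · refine ⟨t * i, ?_⟩
      have h1 := cast_base b hb
      replace h1 : ((t + t : ℕ) : ZMod (b - 1)) = 1 := by rw [← ht]; exact h1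
      push_cast at h1
      calc i = (t + t) * i := by rw [h1, one_mul]
        _ = 2 * (t * i) := by ring
    · exact h
  · exact fun h => Or.inr h

lemma cast_mem_I (b u : ℕ) (hb : 2 ≤ b) (hu : 1 ≤ F b u) : (u : ZMod (b - 1)) ∈ I b := by
  obtain ⟨v, rfl⟩ := (F_pos_iff b u).1 hu
  exact (mem_I_iff b hb _).2 ⟨v, cast_f b hb v⟩

lemma neg_sub_two_mem_I (b : ℕ) (hb : 2 ≤ b) (j : ZMod (b - 1)) (hj : j ∈ I b) :
    -j - 2 ∈ I b := by
  obtain ⟨y, rfl⟩ := (mem_I_iff b hb _).1 hj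
  exact (mem_I_iff b hb _).2 ⟨-y - 1, by ring⟩

/-- The period of `c ↦ 2 * c` modulo `b - 1` in the relevant range. -/
lemma exists_period (b : ℕ) (hb : 2 ≤ b) : ∃ h : ℕ, 1 ≤ h ∧ (2 * (h : ZMod (b - 1)) = 0) ∧
    h ≤ b - 1 ∧ (Odd b → 2 * h = b - 1) ∧ (Even b → h = b - 1) := by
  have h0 : ((b - 1 : ℕ) : ZMod (b - 1)) = 0 := ZMod.natCast_self _
  rcases Nat.even_or_odd b with h | h
  · exact ⟨b - 1, by omega, by rw [h0, mul_zero], le_rfl,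
      fun h' => absurd h (Nat.not_even_iff_odd.2 h'), fun _ => rfl⟩
  · obtain ⟨t, ht⟩ := h
    refine ⟨t, by omega, ?_, by omega, fun _ => by omega, fun ⟨r, hr⟩ => by omega⟩
    have : ((2 * t : ℕ) : ZMod (b - 1)) = 0 := by
      rw [← h0]; congr 1; omega
    exact_mod_cast this

lemma exists_half_of_mem_I (b : ℕ) (hb : 2 ≤ b) (i : ZMod (b - 1)) (hi : i ∈ I b) (h : ℕ)
    (h1 : 1 ≤ h) (h2 : 2 * (h : ZMod (b - 1)) = 0) :
    ∃ x : ℕ, x < h ∧ i = 2 * (x : ZMod (b - 1)) := by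
  have : NeZero (b - 1) := ⟨by omega⟩
  obtain ⟨y, rfl⟩ := (mem_I_iff b hb _).1 hi
  refine ⟨y.val % h, Nat.mod_lt _ h1, ?_⟩
  have e := Nat.div_add_mod y.val h
  calc 2 * y = 2 * ((y.val : ℕ) : ZMod (b - 1)) := by rw [ZMod.natCast_rightInverse y]
    _ = 2 * ((h * (y.val / h) + y.val % h : ℕ) : ZMod (b - 1)) := by rw [e]
    _ = (2 * (h : ZMod (b - 1))) * ((y.val / h : ℕ) : ZMod (b - 1)) +
        2 * ((y.val % h : ℕ) : ZMod (b - 1)) := by push_cast; ring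
    _ = _ := by rw [h2, zero_mul, zero_add]

lemma exists_coeff (b : ℕ) (hb : 2 ≤ b) (i j : ZMod (b - 1)) (hi : i ∈ I b) (hj : j ∈ I b) :
    ∃ c : ℕ, 1 ≤ c ∧ c ≤ b - 1 ∧ (Odd b → 2 * c ≤ b - 1) ∧ i = j + 2 * (c : ZMod (b - 1)) := by
  obtain ⟨h, h1, h2, h3, h4, -⟩ := exists_period b hb
  obtain ⟨y, rfl⟩ := (mem_I_iff b hb _).1 hi
  obtain ⟨z, rfl⟩ := (mem_I_iff b hb _).1 hj
  obtain ⟨x, hx, hxe⟩ := exists_half_of_mem_I b hb (2 * (y - z - 1))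
    ((mem_I_iff b hb _).2 ⟨_, rfl⟩) h h1 h2
  refine ⟨x + 1, by omega, by omega, fun ho => ?_, ?_⟩
  · have := h4 ho
    omega
  · have e : 2 * y = 2 * z + (2 * (y - z - 1) + 2) := by ring
    rw [e, hxe]
    push_cast
    ring

lemma f_of_lt (b w : ℕ) (hb : 2 ≤ b) (hw : w < b) : f b w = 2 * w := by
  unfold f
  rw [s_of_lt b w hb hw]
  ring

lemma even_of_lt (b k : ℕ) (hb : 2 ≤ b) (hk : k < b) (hF : 1 ≤ F b k) : Even k := by
  obtain ⟨w, rfl⟩ := (F_pos_iff b k).1 hF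
  have := le_f b w
  rw [f_of_lt b w hb (by omega)]
  exact even_two_mul w

/-- `IsSplit b n m k k'` says that `k` and `k'` are generated numbers which together have `n`
generators and add up to `(b - 1) * m - 2`. -/
structure IsSplit (b n m k k' : ℕ) : Prop where
  add_eq : k + k' + 2 = (b - 1) * m
  F_add : F b k + F b k' = n
  left : 1 ≤ F b k
  right : 1 ≤ F b k'

lemma IsSplit.symm {b n m k k' : ℕ} (h : IsSplit b n m k k') : IsSplit b n m k' k :=
  ⟨by have := h.add_eq; omega, by have := h.F_add; omega, h.right, h.left⟩

lemma IsSplit.one_le {b n m k k' : ℕ} (h : IsSplit b n m k k') : 1 ≤ m := by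
  rcases Nat.eq_zero_or_pos m with rfl | hm
  · have := h.add_eq
    simp at this
  · exact hm

lemma IsSplit.two_le {b n m k k' : ℕ} (hb : 2 ≤ b) (he : Even b) (h : IsSplit b n m k k') :
    2 ≤ m := by
  by_contra hcon
  have hm : m = 1 := by have := h.one_le; omega
  subst hm
  have e := h.add_eq
  obtain ⟨x, hx⟩ := even_of_lt b k hb (by omega) h.left
  obtain ⟨y, hy⟩ := even_of_lt b k' hb (by omega) h.right
  obtain ⟨z, hz⟩ := he
  omega

lemma IsSplit.lt_pow {b n m k k' : ℕ} (hb : 2 ≤ b) (h : IsSplit b n m k k') (c : ℕ)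
    (hc : c ≤ b - 1) (hc' : Odd b → 2 * c ≤ b - 1) :
    c * (b ^ m + 1) + k < b ^ (m + 1) := by
  have hB := bernoulli b hb m
  have hm := h.one_le
  have e := h.add_eq
  rcases Nat.even_or_odd b with he | ho
  · have hm2 := h.two_le hb he
    obtain ⟨r, rfl⟩ : ∃ r, m = r + 2 := ⟨m - 2, by omega⟩
    have hB' := bernoulli b hb (r + 1)
    obtain ⟨d, rfl⟩ : ∃ d, b = d + 1 := ⟨b - 1, by omega⟩
    simp only [Nat.add_sub_cancel] at *
    have h1 : c * ((d + 1) ^ (r + 2) + 1) ≤ d * ((d + 1) ^ (r + 2) + 1) :=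
      Nat.mul_le_mul_right _ hc
    have e1 : (d + 1) ^ (r + 2) = (d + 1) * (d + 1) ^ (r + 1) := by ring
    have e2 : (d + 1) ^ (r + 2 + 1) = d * (d + 1) ^ (r + 2) + (d + 1) ^ (r + 2) := by ring
    have h2 : (d + 1) * (d * (r + 1) + 1) ≤ (d + 1) * (d + 1) ^ (r + 1) :=
      Nat.mul_le_mul_left _ hB'
    nlinarith [Nat.zero_le (d * d * r)]
  · have h2c := hc' ho
    obtain ⟨d, rfl⟩ : ∃ d, b = d + 1 := ⟨b - 1, by omega⟩
    simp only [Nat.add_sub_cancel] at *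
    have h1 : 2 * c * ((d + 1) ^ m + 1) ≤ d * ((d + 1) ^ m + 1) := Nat.mul_le_mul_right _ h2c
    have e2 : (d + 1) ^ (m + 1) = d * (d + 1) ^ m + (d + 1) ^ m := by ring
    have h3 : d * 1 ≤ d * (d + 1) ^ m := Nat.mul_le_mul_left _ (by omega)
    nlinarith

/-- Every residue class in `I` contains a number with exactly `m` generators. -/
def Attained (b : ℕ) : Prop :=
  ∀ m, 1 ≤ m → ∀ j ∈ I b, ∃ u : ℕ, F b u = m ∧ (u : ZMod (b - 1)) = j

lemma Ki_spec {b : ℕ} (hex : Attained b) (j : ZMod (b - 1)) (hj : j ∈ I b) (m : ℕ) (hm : 1 ≤ m) :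
    F b (Ki b j m) = m ∧ (Ki b j m : ZMod (b - 1)) = j :=
  Nat.sInf_mem (s := {u : ℕ | F b u = m ∧ (u : ZMod (b - 1)) = j}) (hex m hm j hj)

lemma Ki_le (b u : ℕ) : Ki b u (F b u) ≤ u := Nat.sInf_le ⟨rfl, rfl⟩

lemma K_spec {b : ℕ} (hb : 2 ≤ b) (hex : Attained b) (m : ℕ) (hm : 1 ≤ m) : F b (K b m) = m := by
  obtain ⟨u, hu, -⟩ := hex m hm 0 ((mem_I_iff b hb 0).2 ⟨0, by simp⟩)
  exact Nat.sInf_mem (s := {u : ℕ | F b u = m}) ⟨u, hu⟩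

lemma K_le (b u : ℕ) : K b (F b u) ≤ u := Nat.sInf_le rfl

lemma F_zero (b : ℕ) : F b 0 ≤ 1 := by
  unfold F
  refine (Set.ncard_le_one_iff (finite_generators b 0)).2 fun {x y} hx hy => ?_
  have h1 := le_f b x
  have h2 := le_f b y
  simp only [Set.mem_ofPred_eq] at hx hy
  omega

lemma pow_B_le {b : ℕ} (n u : ℕ) (hn : 2 ≤ n) (hu : F b u = n) :
    b ^ B b n ≤ u := by
  have h1 : K b n ≤ u := hu ▸ K_le b u
  refine le_trans (Nat.pow_log_le_self b fun h0 => ?_) h1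
  have hne : {u : ℕ | F b u = n}.Nonempty := ⟨u, hu⟩
  have h2 : F b (K b n) = n := Nat.sInf_mem hne
  rw [h0] at h2
  have := F_zero b
  omega

lemma exists_split_of_lt {b : ℕ} (hb : 2 ≤ b) (n u : ℕ) (hn : 2 ≤ n) (hu : F b u = n)
    (hlt : u < b ^ (B b n + 1)) :
    ∃ c k k', 1 ≤ c ∧ c ≤ b - 1 ∧ u = c * (b ^ B b n + 1) + k ∧ IsSplit b n (B b n) k k' := by
  obtain ⟨c, k, k', h1, h2, h3, h4, h5, h6, h7⟩ := exists_split b hb (B b n) u n (by omega) hu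
    (pow_B_le n u hn hu) hlt fun x hx => pow_B_le n x hn hx
  exact ⟨c, k, k', h1, h2, h3, h4, h5, h6, h7⟩

lemma exists_isSplit {b : ℕ} (hb : 2 ≤ b) (hex : Attained b) (n : ℕ) (hn : 2 ≤ n) :
    ∃ k k', IsSplit b n (B b n) k k' := by
  obtain ⟨c, k, k', -, -, -, h⟩ := exists_split_of_lt hb n (K b n) hn (K_spec hb hex n (by omega))
    (Nat.lt_pow_succ_log_self (by omega) _)
  exact ⟨k, k', h⟩

lemma IsSplit.F_eq {b n m k k' : ℕ} (hb : 2 ≤ b) (h : IsSplit b n m k k') (c : ℕ) (hc1 : 1 ≤ c)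
    (hlt : c * (b ^ m + 1) + k < b ^ (m + 1)) : F b (c * (b ^ m + 1) + k) = n := by
  rw [F_eq_add b hb m c k k' hc1 h.add_eq hlt, h.F_add]

lemma cast_leading (b : ℕ) (hb : 2 ≤ b) (c m k : ℕ) :
    ((c * (b ^ m + 1) + k : ℕ) : ZMod (b - 1)) = k + 2 * c := by
  push_cast
  rw [cast_base b hb, one_pow]
  ring

lemma IsSplit.Ki_le {b n m k k' : ℕ} (hb : 2 ≤ b) (h : IsSplit b n m k k') (j : ZMod (b - 1))
    (c : ℕ) (hc1 : 1 ≤ c) (hlt : c * (b ^ m + 1) + k < b ^ (m + 1))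
    (hj : j = k + 2 * (c : ZMod (b - 1))) : Ki b j n ≤ c * (b ^ m + 1) + k := by
  have := Kaprekar.Ki_le b (c * (b ^ m + 1) + k)
  rwa [h.F_eq hb c hc1 hlt, cast_leading b hb, ← hj] at this

lemma IsSplit.B_le {b n m k k' : ℕ} (hb : 2 ≤ b) (h : IsSplit b n m k k') : B b n ≤ m := by
  have hodd : Odd b → 2 * 1 ≤ b - 1 := by rintro ⟨t, ht⟩; omega
  have hlt := h.lt_pow hb 1 (by omega) hodd
  have hK := K_le b (1 * (b ^ m + 1) + k)
  rw [h.F_eq hb 1 le_rfl hlt] at hK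
  exact Nat.lt_succ_iff.1
    (Nat.log_lt_of_lt_pow' (Nat.succ_ne_zero m) (lt_of_le_of_lt hK hlt))

lemma exists_Ki_le {b : ℕ} (hb : 2 ≤ b) {n m k k' : ℕ} (h : IsSplit b n m k k')
    (j : ZMod (b - 1)) (hj : j ∈ I b) : ∃ c, 1 ≤ c ∧ c ≤ b - 1 ∧ (Odd b → 2 * c ≤ b - 1) ∧
      Ki b j n ≤ c * (b ^ m + 1) + k ∧ c * (b ^ m + 1) + k < b ^ (m + 1) := by
  obtain ⟨c, h1, h2, h3, h4⟩ := exists_coeff b hb j k hj (cast_mem_I b k hb h.left)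
  exact ⟨c, h1, h2, h3, h.Ki_le hb j c h1 (h.lt_pow hb c h2 h3) h4, h.lt_pow hb c h2 h3⟩

lemma Ki_lt_pow {b : ℕ} (hb : 2 ≤ b) (hex : Attained b) (n : ℕ) (hn : 2 ≤ n)
    (j : ZMod (b - 1)) (hj : j ∈ I b) : Ki b j n < b ^ (B b n + 1) := by
  obtain ⟨k, k', h⟩ := exists_isSplit hb hex n hn
  obtain ⟨c, -, -, -, h1, h2⟩ := exists_Ki_le hb h j hj
  omega

lemma pow_lt_Ki {b : ℕ} (hb : 2 ≤ b) (hex : Attained b) (n : ℕ) (hn : 2 ≤ n)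
    (j : ZMod (b - 1)) (hj : j ∈ I b) : b ^ B b n < Ki b j n := by
  obtain ⟨c, k, k', h1, -, h2, -⟩ := exists_split_of_lt hb n _ hn
    (Ki_spec hex j hj n (by omega)).1 (Ki_lt_pow hb hex n hn j hj)
  have := Nat.mul_le_mul_right (b ^ B b n + 1) h1
  omega

/-- The least numbers in complementary classes form a split of some level. -/
lemma exists_isSplit_Ki {b : ℕ} (hb : 2 ≤ b) (hex : Attained b) (p q : ℕ) (hp : 1 ≤ p)
    (hq : 1 ≤ q) (j : ZMod (b - 1)) (hj : j ∈ I b) :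
    ∃ m, IsSplit b (p + q) m (Ki b j p) (Ki b (-j - 2) q) := by
  obtain ⟨h1, h2⟩ := Ki_spec hex j hj p hp
  obtain ⟨h3, h4⟩ := Ki_spec hex _ (neg_sub_two_mem_I b hb j hj) q hq
  have hd : ((Ki b j p + Ki b (-j - 2) q + 2 : ℕ) : ZMod (b - 1)) = 0 := by
    push_cast
    rw [h2, h4]
    ring
  obtain ⟨m, hm⟩ := (ZMod.natCast_eq_zero_iff _ _).1 hd
  exact ⟨m, hm, by rw [h1, h3], by omega, by omega⟩

lemma IsSplit.cast_right {b n m k k' : ℕ} (h : IsSplit b n m k k') :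
    (k' : ZMod (b - 1)) = -k - 2 := by
  have h0 : ((b - 1 : ℕ) : ZMod (b - 1)) = 0 := ZMod.natCast_self _
  have h1 := congrArg (fun x : ℕ => (x : ZMod (b - 1))) h.add_eq
  simp only [Nat.cast_add, Nat.cast_mul, h0, zero_mul, Nat.cast_ofNat] at h1
  linear_combination h1

lemma IsSplit.Ki_right_le {b n m k k' : ℕ} (h : IsSplit b n m k k') :
    Ki b (-(k : ZMod (b - 1)) - 2) (F b k') ≤ k' := by
  rw [← h.cast_right]
  exact Kaprekar.Ki_le b k'

/-- A lower bound for the increments of `B`, depending on the parity of the base. -/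
def gap (b : ℕ) : ℕ := if Even b then 1 else 0

lemma F_two_mul (b : ℕ) (hb : 2 ≤ b) (x : ℕ) (hx : x + 1 < b) (hodd : Odd b → 2 * x < b) :
    F b (2 * x) = 1 := by
  unfold F
  rw [Set.ncard_eq_one]
  refine ⟨x, ?_⟩
  ext v
  simp only [Set.mem_ofPred_eq, Set.mem_singleton_iff]
  constructor
  · intro hv
    have hle := le_f b v
    rcases Nat.lt_or_ge v b with h | h
    · rw [f_of_lt b v hb h] at hv
      omega
    · rcases Nat.even_or_odd b with he | ho
      · obtain ⟨r, rfl⟩ := Nat.exists_eq_add_of_le h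
        have hr : r < b := by omega
        have h1 := f_leading b hb 1 1 r (by omega) (by simpa using hr)
        rw [pow_one, one_mul, one_mul, f_of_lt b r hb hr] at h1
        obtain ⟨t, ht⟩ := he
        omega
      · have := hodd ho
        omega
  · rintro rfl
    exact f_of_lt b v hb (by omega)

lemma Ki_one_gap {b : ℕ} (hb : 2 ≤ b) (hex : Attained b) (j : ZMod (b - 1)) (hj : j ∈ I b) :
    Ki b j 1 + gap b * (b - 1) < Ki b j 2 := by
  obtain ⟨h, h1, h2, h3, h4, h5⟩ := exists_period b hb
  obtain ⟨x, hx, rfl⟩ := exists_half_of_mem_I b hb j hj h h1 h2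
  have hF := F_two_mul b hb x (by omega) fun ho => by have := h4 ho; omega
  have hle := Ki_le b (2 * x)
  rw [hF, Nat.cast_mul, Nat.cast_ofNat] at hle
  have hlt := pow_lt_Ki hb hex 2 le_rfl _ hj
  obtain ⟨k, k', hs⟩ := exists_isSplit hb hex 2 le_rfl
  rcases Nat.even_or_odd b with he | ho
  · have hB := Nat.pow_le_pow_right (show 1 ≤ b by omega) (hs.two_le hb he)
    have := h5 he
    rw [gap, if_pos he, one_mul]
    obtain ⟨d, rfl⟩ : ∃ d, b = d + 2 := ⟨b - 2, by omega⟩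
    have e : (d + 2) ^ 2 = d * d + 4 * d + 4 := by ring
    have := Nat.zero_le (d * d)
    omega
  · have hB := Nat.pow_le_pow_right (show 1 ≤ b by omega) hs.one_le
    have := h4 ho
    rw [gap, if_neg (Nat.not_even_iff_odd.2 ho), zero_mul]
    rw [pow_one] at hB
    omega

lemma B_succ_of_gap {b : ℕ} (hb : 2 ≤ b) (hex : Attained b) (a : ℕ) (ha : 2 ≤ a)
    (ih : ∀ d, 1 ≤ d → d < a → ∀ j ∈ I b, Ki b j d + gap b * (b - 1) < Ki b j (d + 1)) :
    B b a + gap b < B b (a + 1) := by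
  obtain ⟨k, k', h, hk⟩ : ∃ k k', IsSplit b (a + 1) (B b (a + 1)) k k' ∧ 2 ≤ F b k := by
    obtain ⟨k, k', h⟩ := exists_isSplit hb hex (a + 1) (by omega)
    rcases Nat.lt_or_ge (F b k) 2 with h2 | h2
    · exact ⟨k', k, h.symm, by have := h.F_add; omega⟩
    · exact ⟨k, k', h, h2⟩
  have hsum := h.F_add
  have hr := h.right
  have hj := cast_mem_I b k hb h.left
  obtain ⟨M, hM⟩ := exists_isSplit_Ki hb hex (F b k - 1) (F b k') (by omega) hr k hj
  have hgap := ih (F b k - 1) (by omega) (by omega) k hj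
  rw [Nat.sub_add_cancel h.left] at hgap
  have h1 := Kaprekar.Ki_le b k
  have h2 := h.Ki_right_le
  have e1 := hM.add_eq
  have e2 := h.add_eq
  rw [show F b k - 1 + F b k' = a by omega] at hM
  have hB := hM.B_le hb
  have hlt : (b - 1) * (M + gap b) < (b - 1) * B b (a + 1) := by
    rw [Nat.mul_add, mul_comm (b - 1) (gap b)]
    omega
  have := Nat.lt_of_mul_lt_mul_left hlt
  omega

lemma Ki_gap {b : ℕ} (hb : 2 ≤ b) (hex : Attained b) (a : ℕ) :
    1 ≤ a → ∀ j ∈ I b, Ki b j a + gap b * (b - 1) < Ki b j (a + 1) := by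
  induction a using Nat.strong_induction_on with
  | _ a ih =>
    intro ha j hj
    rcases Nat.eq_or_lt_of_le ha with rfl | ha2
    · exact Ki_one_gap hb hex j hj
    · have hB := B_succ_of_gap hb hex a ha2 fun d hd hda => ih d hda hd
      have h1 := Ki_lt_pow hb hex a ha2 j hj
      have h2 := pow_lt_Ki hb hex (a + 1) (by omega) j hj
      have h3 : b ^ (B b a + gap b + 1) ≤ b ^ B b (a + 1) :=
        Nat.pow_le_pow_right (by omega) hB
      unfold gap at *
      split_ifs at *
      · have e : b ^ (B b a + 1 + 1) = b * b ^ (B b a + 1) := by ring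
        have h4 : 2 * b ^ (B b a + 1) ≤ b * b ^ (B b a + 1) := Nat.mul_le_mul_right _ hb
        have h5 : b ≤ b ^ (B b a + 1) := Nat.le_self_pow (by omega) b
        omega
      · simp only [Nat.add_zero, Nat.zero_mul] at *
        omega

lemma B_succ {b : ℕ} (hb : 2 ≤ b) (hex : Attained b) (a : ℕ) (ha : 2 ≤ a) :
    B b a + gap b < B b (a + 1) :=
  B_succ_of_gap hb hex a ha fun d hd _ => Ki_gap hb hex d hd

lemma B_mono {b : ℕ} (hb : 2 ≤ b) (hex : Attained b) (p a : ℕ) (hp : 2 ≤ p) (hpa : p ≤ a) :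
    B b p ≤ B b a := by
  induction a, hpa using Nat.le_induction with
  | base => exact le_rfl
  | succ a hpa ih =>
    have := B_succ hb hex a (by omega)
    omega

lemma Ki_mono {b : ℕ} (hb : 2 ≤ b) (hex : Attained b) (q p : ℕ) (hq : 1 ≤ q) (hqp : q ≤ p)
    (j : ZMod (b - 1)) (hj : j ∈ I b) : Ki b j q ≤ Ki b j p := by
  induction p, hqp using Nat.le_induction with
  | base => exact le_rfl
  | succ a hpa ih =>
    have := Ki_gap hb hex a (by omega) j hj
    omega

lemma pow_ineq_of_odd (d m : ℕ) (hd : 2 ≤ d) (hm : 1 ≤ m) :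
    d + 2 + 4 * (d * m) < d * (d + 1) ^ m + 8 := by
  rcases Nat.lt_or_ge d 4 with h | h
  · have h3 : ∀ x : ℕ, 1 ≤ x → 4 * x ≤ 3 ^ x + 1 ∧ 5 * x ≤ 4 ^ x + 1 := by
      intro x hx
      induction x, hx using Nat.le_induction with
      | base => norm_num
      | succ x hx ih => rw [pow_succ, pow_succ]; omega
    have := h3 m hm
    interval_cases d <;> norm_num <;> omega
  · have hB := bernoulli (d + 1) (by omega) m
    rw [Nat.add_sub_cancel] at hB
    have h1 : d * (d * m + 1) ≤ d * (d + 1) ^ m := Nat.mul_le_mul_left _ hB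
    have h2 : 4 * (d * m) ≤ d * (d * m) := Nat.mul_le_mul_right _ h
    nlinarith

/-- For a suitable class, numbers with at most `p` generators in complementary classes have sum
below every number with `p + 1` generators. -/
lemma exists_add_lt_pow {b : ℕ} (hb : 2 ≤ b) (hex : Attained b) (p q : ℕ) (hp : 2 ≤ p)
    (hq : 1 ≤ q) (hqp : q ≤ p) :
    ∃ j ∈ I b, Ki b j p + Ki b (-j - 2) q < b ^ B b (p + 1) := by
  obtain ⟨k, k', h⟩ := exists_isSplit hb hex p hp
  obtain ⟨w, hw⟩ := (mem_I_iff b hb _).1 (cast_mem_I b k hb h.left)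
  have hj : (k : ZMod (b - 1)) + 2 * ((1 : ℕ) : ZMod (b - 1)) ∈ I b :=
    (mem_I_iff b hb _).2 ⟨w + 1, by rw [hw]; push_cast; ring⟩
  generalize hje : (k : ZMod (b - 1)) + 2 * ((1 : ℕ) : ZMod (b - 1)) = j at hj
  have hj' := neg_sub_two_mem_I b hb j hj
  refine ⟨j, hj, ?_⟩
  have hmono := Ki_mono hb hex q p hq hqp _ hj'
  have hB := B_succ hb hex p hp
  have hpow : b ^ (B b p + gap b + 1) ≤ b ^ B b (p + 1) := Nat.pow_le_pow_right (by omega) hB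
  rcases Nat.even_or_odd b with he | ho
  · rw [gap, if_pos he] at hpow
    have h1 := Ki_lt_pow hb hex p hp j hj
    have h2 := Ki_lt_pow hb hex p hp _ hj'
    have e : b ^ (B b p + 1 + 1) = b * b ^ (B b p + 1) := by ring
    have h4 : 2 * b ^ (B b p + 1) ≤ b * b ^ (B b p + 1) := Nat.mul_le_mul_right _ hb
    omega
  · rw [gap, if_neg (Nat.not_even_iff_odd.2 ho), Nat.add_zero] at hpow
    have hodd : Odd b → 2 * 1 ≤ b - 1 := by rintro ⟨t, ht⟩; omega
    have h1 := h.Ki_le hb j 1 le_rfl (h.lt_pow hb 1 (by omega) hodd) hje.symm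
    obtain ⟨c, -, -, hc, h2, -⟩ := exists_Ki_le hb h _ hj'
    have hc2 := hc ho
    have hb3 := hodd ho
    have e := h.add_eq
    have hineq := pow_ineq_of_odd (b - 1) (B b p) (by omega) h.one_le
    obtain ⟨d, rfl⟩ : ∃ d, b = d + 1 := ⟨b - 1, by omega⟩
    simp only [Nat.add_sub_cancel] at *
    have h3 : 2 * c * ((d + 1) ^ B (d + 1) p + 1) ≤ d * ((d + 1) ^ B (d + 1) p + 1) :=
      Nat.mul_le_mul_right _ hc2
    have e2 : (d + 1) ^ (B (d + 1) p + 1) =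
      d * (d + 1) ^ B (d + 1) p + (d + 1) ^ B (d + 1) p := by ring
    nlinarith

lemma IsSplit.F_left_le {b n k k' : ℕ} (hb : 2 ≤ b) (hex : Attained b)
    (h : IsSplit b n (B b n) k k') : F b k ≤ (n + 1) / 2 := by
  by_contra hcon
  have hsum := h.F_add
  have hr := h.right
  have e := h.add_eq
  obtain ⟨j, hj, hlt⟩ := exists_add_lt_pow hb hex ((n + 1) / 2) (n / 2) (by omega) (by omega)
    (by omega)
  obtain ⟨M, hM⟩ := exists_isSplit_Ki hb hex ((n + 1) / 2) (n / 2) (by omega) (by omega) j hj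
  have e' := hM.add_eq
  rw [show (n + 1) / 2 + n / 2 = n by omega] at hM
  have h1 := Nat.mul_le_mul_left (b - 1) (hM.B_le hb)
  have h2 := pow_B_le (F b k) k (by omega) rfl
  have h3 : b ^ B b ((n + 1) / 2 + 1) ≤ b ^ B b (F b k) :=
    Nat.pow_le_pow_right (by omega) (B_mono hb hex _ _ (by omega) (by omega))
  omega

lemma le_Ki_add {b : ℕ} (hb : 2 ≤ b) (hex : Attained b) (p q : ℕ) (hp : 1 ≤ p) (hq : 1 ≤ q)
    (j : ZMod (b - 1)) (hj : j ∈ I b) :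
    (b - 1) * B b (p + q) ≤ Ki b j p + Ki b (-j - 2) q + 2 := by
  obtain ⟨M, hM⟩ := exists_isSplit_Ki hb hex p q hp hq j hj
  rw [hM.add_eq]
  exact Nat.mul_le_mul_left _ (hM.B_le hb)

lemma IsSplit.eq_Ki {b n k k' : ℕ} (hb : 2 ≤ b) (hex : Attained b)
    (h : IsSplit b n (B b n) k k') :
    k = Ki b k (F b k) ∧ k' = Ki b (-(k : ZMod (b - 1)) - 2) (F b k') := by
  have h1 := le_Ki_add hb hex _ _ h.left h.right k (cast_mem_I b k hb h.left)
  rw [h.F_add, ← h.add_eq] at h1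
  have h2 := Kaprekar.Ki_le b k
  have h3 := h.Ki_right_le
  omega

lemma IsSplit.K'_eq {b n k k' : ℕ} (hb : 2 ≤ b) (hex : Attained b) (hn : 2 ≤ n)
    (h : IsSplit b n (B b n) k k') : K' b k n + 2 = (b - 1) * B b n := by
  have hj := cast_mem_I b k hb h.left
  have h1 := le_Ki_add hb hex ((n + 1) / 2) (n / 2) (by omega) (by omega) _ hj
  have h2 := le_Ki_add hb hex (n / 2) ((n + 1) / 2) (by omega) (by omega) _ hj
  rw [show (n + 1) / 2 + n / 2 = n by omega] at h1
  rw [show n / 2 + (n + 1) / 2 = n by omega] at h2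
  have h3 := h.F_left_le hb hex
  have h4 := h.symm.F_left_le hb hex
  obtain ⟨h5, h6⟩ := h.eq_Ki hb hex
  have hsum := h.F_add
  have e := h.add_eq
  unfold K'
  rcases (by omega : (F b k = (n + 1) / 2 ∧ F b k' = n / 2) ∨
    (F b k = n / 2 ∧ F b k' = (n + 1) / 2)) with ⟨ha, ha'⟩ | ⟨ha, ha'⟩
  all_goals
    rw [ha] at h5
    rw [ha'] at h6
    omega

lemma le_K' {b : ℕ} (hb : 2 ≤ b) (hex : Attained b) (n : ℕ) (hn : 2 ≤ n) (j : ZMod (b - 1))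
    (hj : j ∈ I b) : (b - 1) * B b n ≤ K' b j n + 2 := by
  have h1 := le_Ki_add hb hex ((n + 1) / 2) (n / 2) (by omega) (by omega) _ hj
  have h2 := le_Ki_add hb hex (n / 2) ((n + 1) / 2) (by omega) (by omega) _ hj
  rw [show (n + 1) / 2 + n / 2 = n by omega] at h1
  rw [show n / 2 + (n + 1) / 2 = n by omega] at h2
  unfold K'
  omega

lemma sInf_K' {b : ℕ} (hb : 2 ≤ b) (hex : Attained b) (n : ℕ) (hn : 2 ≤ n) :
    sInf {x : ℕ | ∃ j ∈ I b, x = K' b j n} + 2 = (b - 1) * B b n := by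
  obtain ⟨k, k', h⟩ := exists_isSplit hb hex n hn
  have hj := cast_mem_I b k hb h.left
  have h1 := h.K'_eq hb hex hn
  have hmem : K' b k n ∈ {x : ℕ | ∃ j ∈ I b, x = K' b j n} := ⟨k, hj, rfl⟩
  have h2 := Nat.sInf_le hmem
  obtain ⟨j, hj', h3⟩ := Nat.sInf_mem ⟨_, hmem⟩
  have h4 := le_K' hb hex n hn j hj'
  omega

theorem stmt18 (b : ℕ) (hb : 2 ≤ b) (i : ZMod (b - 1)) (hi : i ∈ I b) (n : ℕ) (hn : 2 ≤ n)
    (hex : ∀ m, 1 ≤ m → ∀ j ∈ I b, ∃ u : ℕ, F b u = m ∧ (u : ZMod (b - 1)) = j) :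
    Ki b i n = cc b i n * (b ^ B b n + 1) +
      Ki b (i - 2 * (cc b i n : ZMod (b - 1))) (hh b i n) ∧
    1 ≤ cc b i n ∧ cc b i n ≤ b - 1 ∧ (Odd b → 2 * cc b i n ≤ b - 1) ∧
    (Ki b (i - 2 * (cc b i n : ZMod (b - 1))) (hh b i n) : ℤ) ≤
      ((b : ℤ) - 1) * B b n - 2 := by
  have hatt : Attained b := hex
  obtain ⟨c₀, k, k', hc₀, hc₀', hu, h⟩ := exists_split_of_lt hb n _ hn
    (Ki_spec hatt i hi n (by omega)).1 (Ki_lt_pow hb hatt n hn i hi)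
  have hi' : i = k + 2 * (c₀ : ZMod (b - 1)) := by
    rw [← cast_leading b hb c₀ (B b n) k, ← hu, (Ki_spec hatt i hi n (by omega)).2]
  have hki : i - 2 * (c₀ : ZMod (b - 1)) = k := by rw [hi']; ring
  have hinf := sInf_K' hb hatt n hn
  have hmem₀ : c₀ ∈ {c : ℕ | 1 ≤ c ∧ K' b (i - 2 * (c : ZMod (b - 1))) n =
      sInf {x : ℕ | ∃ j ∈ I b, x = K' b j n}} := by
    refine ⟨hc₀, ?_⟩
    have := h.K'_eq hb hatt hn
    rw [hki]
    omega
  have hle : cc b i n ≤ c₀ := Nat.sInf_le hmem₀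
  obtain ⟨hc1, hcK⟩ := Nat.sInf_mem ⟨_, hmem₀⟩
  change 1 ≤ cc b i n at hc1
  change K' b (i - 2 * (cc b i n : ZMod (b - 1))) n = _ at hcK
  have hodd : Odd b → 2 * cc b i n ≤ b - 1 := by
    intro ho
    obtain ⟨p, hp1, hp2, -, hp3, -⟩ := exists_period b hb
    have hp := hp3 ho
    by_contra hcon
    have hmem : cc b i n - p ∈ {c : ℕ | 1 ≤ c ∧ K' b (i - 2 * (c : ZMod (b - 1))) n =
        sInf {x : ℕ | ∃ j ∈ I b, x = K' b j n}} := by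
      refine ⟨by omega, ?_⟩
      rw [← hcK, Nat.cast_sub (by omega), mul_sub, hp2, sub_zero]
    have : cc b i n ≤ cc b i n - p := Nat.sInf_le hmem
    omega
  have hneg : 2 * (cc b i n : ZMod (b - 1)) - i - 2 = -(i - 2 * (cc b i n : ZMod (b - 1))) - 2 := by
    ring
  have hh_def : hh b i n = if Ki b (i - 2 * (cc b i n : ZMod (b - 1))) ((n + 1) / 2) +
       Ki b (-(i - 2 * (cc b i n : ZMod (b - 1))) - 2) (n / 2) <
     Ki b (i - 2 * (cc b i n : ZMod (b - 1))) (n / 2) +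
       Ki b (-(i - 2 * (cc b i n : ZMod (b - 1))) - 2) ((n + 1) / 2)
      then (n + 1) / 2 else n / 2 := by
    rw [← hneg]
    rfl
  have hcb : cc b i n ≤ b - 1 := hle.trans hc₀'
  have hij : i = (i - 2 * (cc b i n : ZMod (b - 1))) + 2 * (cc b i n : ZMod (b - 1)) := by ring
  have hj : i - 2 * (cc b i n : ZMod (b - 1)) ∈ I b := by
    obtain ⟨y, hy⟩ := (mem_I_iff b hb _).1 hi
    exact (mem_I_iff b hb _).2 ⟨y - (cc b i n : ZMod (b - 1)), by rw [hy]; ring⟩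
  have hjc : cc b i n = c₀ → i - 2 * (cc b i n : ZMod (b - 1)) = k := by
    intro e
    rw [e, hki]
  generalize hJ : i - 2 * (cc b i n : ZMod (b - 1)) = j at *
  generalize cc b i n = c at *
  obtain ⟨g, hg1, hgh, hsum⟩ : ∃ g, 1 ≤ g ∧ hh b i n + g = n ∧
      Ki b j (hh b i n) + Ki b (-j - 2) g = K' b j n := by
    rw [hh_def]
    unfold K'
    split_ifs with hX
    · exact ⟨n / 2, by omega, by omega, by omega⟩
    · exact ⟨(n + 1) / 2, by omega, by omega, by omega⟩
  have hh1 : 1 ≤ hh b i n := by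
    rw [hh_def]
    split_ifs <;> omega
  obtain ⟨M, hM⟩ := exists_isSplit_Ki hb hatt (hh b i n) g hh1 hg1 j hj
  have hMB : (b - 1) * B b n = (b - 1) * M := by
    have := hM.add_eq
    omega
  have hMB' : M = B b n := (Nat.eq_of_mul_eq_mul_left (by omega) hMB).symm
  rw [hgh, hMB'] at hM
  have hub := hM.Ki_le hb i c hc1 (hM.lt_pow hb c hcb hodd)
    (by rw [(Ki_spec hatt j hj _ hh1).2]; exact hij)
  have hMe := hM.add_eq
  have hbern := bernoulli b hb (B b n)
  have hcc : c = c₀ := by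
    by_contra hne
    obtain ⟨x, rfl⟩ : ∃ x, c₀ = c + 1 + x := ⟨c₀ - c - 1, by omega⟩
    have e1 : (c + 1 + x) * (b ^ B b n + 1) =
      c * (b ^ B b n + 1) + (b ^ B b n + 1) + x * (b ^ B b n + 1) := by ring
    have := Nat.zero_le (x * (b ^ B b n + 1))
    omega
  have hjk := hjc hcc
  subst hcc
  have hkle : k ≤ Ki b j (hh b i n) := by omega
  have hk : k = Ki b j (hh b i n) := by
    obtain ⟨h5, h6⟩ := h.eq_Ki hb hatt
    have h3 := h.F_left_le hb hatt
    have h4 := h.symm.F_left_le hb hatt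
    have hFs := h.F_add
    have he := h.add_eq
    rw [← hjk] at h5 h6
    by_cases heq : F b k = hh b i n
    · rwa [heq] at h5
    · exfalso
      unfold K' at hsum hcK
      rcases (by omega : (F b k = (n + 1) / 2 ∧ F b k' = n / 2) ∨
        (F b k = n / 2 ∧ F b k' = (n + 1) / 2)) with ⟨ha, ha'⟩ | ⟨ha, ha'⟩
      · rw [ha] at h5
        rw [ha'] at h6
        have hhq : hh b i n = n / 2 := by
          rw [hh_def] at heq ⊢
          split_ifs at heq ⊢ <;> omega
        have hgap := Ki_gap hb hatt (n / 2) (by omega) j hj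
        rw [hhq] at hkle heq
        rw [show n / 2 + 1 = (n + 1) / 2 by omega] at hgap
        omega
      · rw [ha] at h5
        rw [ha'] at h6
        rw [hh_def] at heq
        split_ifs at heq <;> omega
  refine ⟨by omega, hc1, hcb, hodd, ?_⟩
  have hz : (Ki b j (hh b i n) + Ki b (-j - 2) g + 2 : ℤ) = ((b : ℤ) - 1) * B b n := by
    have hc := congrArg (fun x : ℕ => (x : ℤ)) hMe
    simp only [Nat.cast_add, Nat.cast_mul, Nat.cast_ofNat] at hc
    rw [hc, Nat.cast_sub (by omega), Nat.cast_one]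
  omega

end Kaprekar
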